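/- Let n ≥ 1 and Δ = 2^n. For any 2D range [l₁,u₁)×[l₂,u₂) with 0 ≤ l₁ < u₁ ≤ Δ and 0 ≤ l₂ < u₂ ≤ Δ, the vector (H⊗H)·(𝟙_{[l₁,u₁)} ⊗ 𝟙_{[l₂,u₂)}) has at most (2n+2)² nonzero entries, where ⊗ denotes the Kronecker product. -/

import Mathlib

open Matrix

/-- The scale of the Haar row index `i`: row `0` is the special row of scale `-1`;
row `i ≥ 1` corresponds to the pair `(m, j)` with `m = ⌊log₂ i⌋` and `j = i - 2^m`. -/
def haarScale (i : ℕ) : ℤ := if i = 0 then -1 else (Nat.log 2 i : ℤ)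

/-- Entry of the `2^n × 2^n` Haar matrix, with rows indexed by `i ∈ [0, 2^n)` via the
standard bijection `i = 0 ↔ (m, j) = (-1, 0)` and `i = 2^m + j ↔ (m, j)` for `m ≥ 0`,
`0 ≤ j < 2^m`.  The row `(-1, 0)` is constant `Δ^{-1/2}`; the row `(m, j)` with `m ≥ 0`
takes the value `√(2^m/Δ)` on `[jΔ/2^m, jΔ/2^m + Δ/2^(m+1))`, the value `-√(2^m/Δ)` on
`[jΔ/2^m + Δ/2^(m+1), (j+1)Δ/2^m)`, and `0` elsewhere, where `Δ = 2^n`. -/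
noncomputable def haarEntry (n : ℕ) (i c : ℕ) : ℝ :=
  if i = 0 then (Real.sqrt (2 ^ n))⁻¹
  else
    let m := Nat.log 2 i
    let j := i - 2 ^ m
    if j * (2 ^ n / 2 ^ m) ≤ c ∧ c < j * (2 ^ n / 2 ^ m) + 2 ^ n / 2 ^ (m + 1) then
      Real.sqrt ((2 ^ m : ℝ) / 2 ^ n)
    else if j * (2 ^ n / 2 ^ m) + 2 ^ n / 2 ^ (m + 1) ≤ c ∧ c < (j + 1) * (2 ^ n / 2 ^ m) then
      -Real.sqrt ((2 ^ m : ℝ) / 2 ^ n)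
    else 0

/-- The `2^n × 2^n` Haar matrix. -/
noncomputable def haarMatrix (n : ℕ) : Matrix (Fin (2 ^ n)) (Fin (2 ^ n)) ℝ :=
  Matrix.of fun i c => haarEntry n i.val c.val

/-- The indicator vector of the range `[l, u)` in the universe `[0, Δ)`. -/
def indVec (Δ l u : ℕ) : Fin Δ → ℝ := fun c => if l ≤ (c : ℕ) ∧ (c : ℕ) < u then 1 else 0

theorem sum_fin_Ico_indicator {N a b : ℕ} (hb : b ≤ N) :
    ∑ c : Fin N, (if a ≤ (c : ℕ) ∧ (c : ℕ) < b then (1 : ℝ) else 0) = (b - a : ℕ) := by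
  rw [Fin.sum_univ_eq_sum_range (fun c => if a ≤ c ∧ c < b then (1 : ℝ) else 0) N,
    Finset.sum_boole]
  have : (Finset.range N).filter (fun c => a ≤ c ∧ c < b) = Finset.Ico a b := by
    ext c
    simp only [Finset.mem_filter, Finset.mem_range, Finset.mem_Ico]
    omega
  rw [this, Nat.card_Ico]

/-- A Haar wavelet is orthogonal to the indicator of `[l, u)` when neither endpoint lies in
its support. -/
theorem haarMatrix_mulVec_indVec_eq_zero (n l u : ℕ) (i : Fin (2 ^ n))
    (hi : (i : ℕ) ≠ 0)
    (hl : l / 2 ^ (n - Nat.log 2 i) ≠ i - 2 ^ Nat.log 2 i)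
    (hu : u / 2 ^ (n - Nat.log 2 i) ≠ i - 2 ^ Nat.log 2 i) :
    (haarMatrix n *ᵥ indVec (2 ^ n) l u) i = 0 := by
  have hmn : Nat.log 2 i < n := Nat.log_lt_of_lt_pow hi i.isLt
  have hlow : 2 ^ Nat.log 2 i ≤ (i : ℕ) := Nat.pow_log_le_self 2 hi
  have hup : (i : ℕ) < 2 ^ (Nat.log 2 i + 1) := Nat.lt_pow_succ_log_self (by norm_num) _
  simp only [mulVec, dotProduct, haarMatrix, Matrix.of_apply, haarEntry, indVec, if_neg hi]
  generalize Nat.log 2 (i : ℕ) = m at *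
  rw [Nat.pow_div hmn.le (by norm_num), Nat.pow_div hmn (by norm_num)]
  obtain ⟨j, hj⟩ : ∃ j, (i : ℕ) - 2 ^ m = j := ⟨_, rfl⟩
  rw [hj] at hl hu ⊢
  have hjm : j + 1 ≤ 2 ^ m := by
    rw [pow_succ] at hup
    omega
  have hB : 2 ^ (n - m) = 2 * 2 ^ (n - (m + 1)) := by
    rw [← pow_succ']
    congr 1
    omega
  have hend : (j + 1) * 2 ^ (n - m) ≤ 2 ^ n := by
    calc (j + 1) * 2 ^ (n - m) ≤ 2 ^ m * 2 ^ (n - m) := Nat.mul_le_mul_right _ hjm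
      _ = 2 ^ n := by rw [← pow_add]; congr 1; omega
  have hBpos : 0 < 2 ^ (n - m) := by positivity
  have hout : ∀ x, x / 2 ^ (n - m) ≠ j →
      x < j * 2 ^ (n - m) ∨ (j + 1) * 2 ^ (n - m) ≤ x := by
    intro x hx
    rcases lt_or_gt_of_ne hx with h | h
    · exact Or.inl ((Nat.div_lt_iff_lt_mul hBpos).1 h)
    · exact Or.inr ((Nat.le_div_iff_mul_le hBpos).1 h)
  have hl' := hout l hl
  have hu' := hout u hu
  rw [Nat.succ_mul] at hend hl' hu' ⊢
  generalize j * 2 ^ (n - m) = a at *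
  rw [hB] at *
  generalize 2 ^ (n - (m + 1)) = h at *
  generalize √((2 : ℝ) ^ m / 2 ^ n) = s
  have hterm : ∀ c : Fin (2 ^ n),
      (if a ≤ (c : ℕ) ∧ (c : ℕ) < a + h then s
        else if a + h ≤ (c : ℕ) ∧ (c : ℕ) < a + 2 * h then -s else 0) *
        (if l ≤ (c : ℕ) ∧ (c : ℕ) < u then 1 else 0) =
      (if l ≤ a ∧ a + 2 * h ≤ u then s else 0) *
        ((if a ≤ (c : ℕ) ∧ (c : ℕ) < a + h then 1 else 0) -
          (if a + h ≤ (c : ℕ) ∧ (c : ℕ) < a + 2 * h then 1 else 0)) := by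
    intro c
    split_ifs <;> first | omega | simp
  rw [Finset.sum_congr rfl fun c _ => hterm c, ← Finset.mul_sum, Finset.sum_sub_distrib,
    sum_fin_Ico_indicator (by omega), sum_fin_Ico_indicator hend,
    show a + h - a = a + 2 * h - (a + h) by omega, sub_self, mul_zero]

/-- The Haar transform of the indicator of `[l, u)` has at most `2n + 1` nonzero entries. -/
theorem haarMatrix_mulVec_indVec_nonzero_card_le (n l u : ℕ) :
    (Finset.univ.filter fun i : Fin (2 ^ n) =>
      (haarMatrix n *ᵥ indVec (2 ^ n) l u) i ≠ 0).card ≤ 2 * n + 1 := by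
  let touching (x : ℕ) : Finset ℕ := (Finset.range n).image fun m => x / 2 ^ (n - m) + 2 ^ m
  have hcard (x : ℕ) : (touching x).card ≤ n :=
    Finset.card_image_le.trans (Finset.card_range n).le
  have hsub : ((Finset.univ.filter fun i : Fin (2 ^ n) =>
      (haarMatrix n *ᵥ indVec (2 ^ n) l u) i ≠ 0).map Fin.valEmbedding) ⊆
      insert 0 (touching l ∪ touching u) := by
    intro k hk
    obtain ⟨i, hi, rfl⟩ := Finset.mem_map.1 hk
    rw [Finset.mem_filter] at hi
    rw [Fin.valEmbedding_apply, Finset.mem_insert, Finset.mem_union]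
    by_contra! hcon
    obtain ⟨h0, hl, hu⟩ := hcon
    have hlow : 2 ^ Nat.log 2 i ≤ (i : ℕ) := Nat.pow_log_le_self 2 h0
    have hm : Nat.log 2 i ∈ Finset.range n :=
      Finset.mem_range.2 (Nat.log_lt_of_lt_pow h0 i.isLt)
    refine hi.2 (haarMatrix_mulVec_indVec_eq_zero n l u i h0 (fun h => hl ?_)
      (fun h => hu ?_)) <;>
    exact Finset.mem_image.2 ⟨_, hm, by omega⟩
  rw [← Finset.card_map Fin.valEmbedding]
  have h1 := Finset.card_le_card hsub
  have h2 := Finset.card_insert_le 0 (touching l ∪ touching u)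
  have h3 := Finset.card_union_le (touching l) (touching u)
  have := hcard l
  have := hcard u
  omega

open Kronecker in
theorem kronecker_mulVec_mul {α β γ δ : Type*} [Fintype γ] [Fintype δ]
    (A : Matrix α γ ℝ) (B : Matrix β δ ℝ) (v : γ → ℝ) (w : δ → ℝ) (i : α × β) :
    ((A ⊗ₖ B) *ᵥ fun c => v c.1 * w c.2) i = (A *ᵥ v) i.1 * (B *ᵥ w) i.2 := by
  simp only [mulVec, dotProduct, kroneckerMap_apply, Fintype.sum_prod_type,
    Finset.sum_mul_sum]
  exact Finset.sum_congr rfl fun _ _ => Finset.sum_congr rfl fun _ _ => by ring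

open Kronecker in
/-- For `n ≥ 1`, `Δ = 2^n` and any 2D range `[l₁,u₁) × [l₂,u₂)` with
`0 ≤ lₜ < uₜ ≤ Δ`, the vector `(H ⊗ H) · (𝟙_{[l₁,u₁)} ⊗ 𝟙_{[l₂,u₂)})` has at most
`(2n+2)²` nonzero entries. -/
theorem haar2D_indicator_nonzero_card_le (n : ℕ) (hn : 1 ≤ n) (l₁ u₁ l₂ u₂ : ℕ)
    (hlu₁ : l₁ < u₁) (hu₁ : u₁ ≤ 2 ^ n) (hlu₂ : l₂ < u₂) (hu₂ : u₂ ≤ 2 ^ n) :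
    (Finset.univ.filter fun i : Fin (2 ^ n) × Fin (2 ^ n) =>
      (haarMatrix n ⊗ₖ haarMatrix n).mulVec
        (fun c => indVec (2 ^ n) l₁ u₁ c.1 * indVec (2 ^ n) l₂ u₂ c.2) i ≠ 0).card
      ≤ (2 * n + 2) ^ 2 := by
  simp only [kronecker_mulVec_mul, mul_ne_zero_iff]
  have hprod : ∀ p q : Fin (2 ^ n) → ℝ,
      (Finset.univ.filter fun i : Fin (2 ^ n) × Fin (2 ^ n) => p i.1 ≠ 0 ∧ q i.2 ≠ 0) =
        (Finset.univ.filter fun i => p i ≠ 0) ×ˢ (Finset.univ.filter fun i => q i ≠ 0) := by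
    intro p q
    ext
    simp
  refine le_of_eq_of_le ?_ (Nat.mul_le_mul
    ((haarMatrix_mulVec_indVec_nonzero_card_le n l₁ u₁).trans (by omega))
    ((haarMatrix_mulVec_indVec_nonzero_card_le n l₂ u₂).trans (by omega)) |>.trans (sq _).ge)
  rw [← Finset.card_product, ← hprod]
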